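/- Let R be a Noetherian commutative ring such that R/I is Cohen–Macaulay for an ideal I ⊆ R, let g_d ∈ I, and let g_{d-1} ∈ R be a nonzerodivisor on R/I. Then R[x_n]/(I, g_{d-1}x_n + g_d) is Cohen–Macaulay of codimension height(I) + 1. -/

import Mathlib

/-- The height of an ideal: the infimum of the heights of the primes containing it. -/
noncomputable def idealHeight {R : Type*} [CommRing R] (I : Ideal R) : ℕ∞ :=
  ⨅ p : {p : PrimeSpectrum R // I ≤ p.asIdeal}, Order.height p.1

/-- The grade (depth) of an ideal on `R`: the supremum of the lengths of regular sequences
contained in it. -/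
noncomputable def idealGrade {R : Type*} [CommRing R] (I : Ideal R) : ℕ∞ :=
  ⨆ rs : {rs : List R // (∀ r ∈ rs, r ∈ I) ∧ RingTheory.Sequence.IsRegular R rs},
    (rs.1.length : ℕ∞)

/-- A (Noetherian) ring is Cohen–Macaulay iff `grade I = height I` for every proper ideal. -/
def IsCohenMacaulayRing (R : Type*) [CommRing R] : Prop :=
  ∀ I : Ideal R, I ≠ ⊤ → idealGrade I = idealHeight I

/-- An ideal `I` is perfect of codimension 2 if it has height 2 and `R/I` admits a finite
free resolution `0 → F₁ → F₀ → R → R/I → 0`. -/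
def IsPerfectCodimTwo {R : Type*} [CommRing R] (I : Ideal R) : Prop :=
  idealHeight I = 2 ∧
    ∃ (a b : ℕ) (φ : (Fin b → R) →ₗ[R] (Fin a → R)) (ψ : (Fin a → R) →ₗ[R] R),
      Function.Injective φ ∧ LinearMap.range φ = LinearMap.ker ψ ∧ LinearMap.range ψ = I

section

universe u

open RingTheory.Sequence CategoryTheory CategoryTheory.Abelian

theorem subsingleton_ext_quotSMulTop {R : Type u} [CommRing R] {N M : ModuleCat.{u} R} {r : R}
    (hr : IsSMulRegular M r) {n : ℕ} (h : ∀ i < n + 1, Subsingleton (Ext N M i)) :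
    ∀ i < n, Subsingleton (Ext N (ModuleCat.of R (QuotSMulTop r M)) i) := by
  intro i hi
  have zero1 := AddCommGrpCat.isZero_of_iff_subsingleton.mpr (h i (by omega))
  have zero2 := AddCommGrpCat.isZero_of_iff_subsingleton.mpr (h (i + 1) (by omega))
  exact AddCommGrpCat.subsingleton_of_isZero <| ShortComplex.Exact.isZero_of_both_zeros
    ((Ext.covariant_sequence_exact₃' N hr.smulShortComplex_shortExact) i (i + 1) rfl)
    (zero1.eq_zero_of_src _) (zero2.eq_zero_of_tgt _)

theorem eq_zero_of_smul_eq_zero_of_subsingleton_ext {R : Type u} [CommRing R] {P : Ideal R}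
    {M : ModuleCat.{u} R} (h : Subsingleton (Ext (ModuleCat.of R (R ⧸ P)) M 0))
    {u : M} (hu : ∀ p ∈ P, p • u = 0) : u = 0 := by
  have : Subsingleton (ModuleCat.of R (R ⧸ P) ⟶ M) := Ext.addEquiv₀.subsingleton_congr.mp h
  have : Subsingleton ((R ⧸ P) →ₗ[R] M) :=
    (ModuleCat.homAddEquiv (M := ModuleCat.of R (R ⧸ P)) (N := M)).symm.subsingleton
  let φ : (R ⧸ P) →ₗ[R] M := P.liftQ (LinearMap.toSpanSingleton R M u) fun p hp => by
    rw [LinearMap.mem_ker, LinearMap.toSpanSingleton_apply, hu p hp]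
  have hφ : φ (Submodule.Quotient.mk 1) = u :=
    (P.liftQ_apply _ 1).trans (one_smul R u)
  rw [← hφ, Subsingleton.elim φ 0, LinearMap.zero_apply]

theorem eq_zero_of_smul_eq_zero_of_isWeaklyRegular {R : Type u} [CommRing R] {P : Ideal R}
    (rs : List R) (M : Type u) [AddCommGroup M] [Module R M] (hrs : IsWeaklyRegular M rs)
    (h : ∀ i < rs.length + 1, Subsingleton (Ext (ModuleCat.of R (R ⧸ P)) (ModuleCat.of R M) i))
    {u : M ⧸ (Ideal.ofList rs • ⊤ : Submodule R M)} (hu : ∀ p ∈ P, p • u = 0) : u = 0 := by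
  induction rs generalizing M with
  | nil =>
    let e : (M ⧸ (Ideal.ofList ([] : List R) • ⊤ : Submodule R M)) ≃ₗ[R] M :=
      Submodule.quotEquivOfEqBot _ <| by
        rw [Ideal.ofList_nil]
        exact Submodule.bot_smul _
    refine (map_eq_zero_iff e e.injective).mp ?_
    exact eq_zero_of_smul_eq_zero_of_subsingleton_ext (M := ModuleCat.of R M) (h 0 (by simp))
      fun p hp => by
        have := congrArg e (hu p hp)
        rwa [map_smul, map_zero] at this
  | cons r rs ih =>
    rw [isWeaklyRegular_cons_iff] at hrs
    let e := Submodule.quotOfListConsSMulTopEquivQuotSMulTopInner M r rs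
    refine (map_eq_zero_iff e e.injective).mp ?_
    refine ih _ hrs.2 (subsingleton_ext_quotSMulTop (M := ModuleCat.of R M) hrs.1 h) fun p hp => ?_
    rw [← map_smul, hu p hp, map_zero]

/-- A regular sequence in `P` is no longer than a weakly regular sequence `rs` whose quotient
has a nonzero element annihilated by `P`. -/
theorem length_le_length_of_smul_mem {R : Type u} [CommRing R] [IsNoetherianRing R] {P : Ideal R}
    (hP : P ≠ ⊤) {rs ys : List R} (hrs : IsWeaklyRegular R rs) (hys : IsRegular R ys)
    (hysP : ∀ y ∈ ys, y ∈ P) {u : R} (hu : u ∉ Ideal.ofList rs)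
    (hPu : ∀ p ∈ P, p * u ∈ Ideal.ofList rs) : ys.length ≤ rs.length := by
  by_contra! hlt
  have hext := ModuleCat.subsingleton_ext_of_exists_isRegular P (ModuleCat.of R (R ⧸ P))
    (by simp [Module.support_eq_zeroLocus, Ideal.annihilator_quotient]) (ModuleCat.of R R)
    (by simpa [lt_top_iff_ne_top] using hP) ys hysP hys
  have h0 := eq_zero_of_smul_eq_zero_of_isWeaklyRegular (P := P) rs R hrs
    (fun i hi => hext i (by omega)) (u := Submodule.Quotient.mk u) (fun p hp => by
      rw [← Submodule.Quotient.mk_smul, Submodule.Quotient.mk_eq_zero]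
      simpa using hPu p hp)
  rw [Submodule.Quotient.mk_eq_zero] at h0
  exact hu (by simpa using h0)

theorem idealHeight_eq_height {R : Type*} [CommRing R] (I : Ideal R) :
    idealHeight I = I.height := by
  refine le_antisymm ?_ (le_iInf fun p => ?_)
  · rw [Ideal.height_eq_inf_minimalPrimes]
    refine le_iInf₂ fun J hJ => ?_
    rw [PrimeSpectrum.height_eq_orderHeight ⟨J, hJ.isPrime⟩]
    exact iInf_le (fun p : {p : PrimeSpectrum R // I ≤ p.asIdeal} => Order.height p.1)
      ⟨⟨J, hJ.isPrime⟩, hJ.1.2⟩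
  · rw [← PrimeSpectrum.height_eq_orderHeight]
    exact Ideal.height_mono p.2

theorem height_add_one_le_of_mem {R : Type*} [CommRing R] {I P : Ideal R} [P.IsPrime] {a : R}
    (ha : ∀ r : R, a * r ∈ I → r ∈ I) (hIP : I ≤ P) (haP : a ∈ P) :
    I.height + 1 ≤ P.height := by
  obtain ⟨q, hq, hqP⟩ := Ideal.exists_minimalPrimes_le hIP
  have := hq.isPrime
  have hlt : q < P := by
    refine lt_of_le_of_ne hqP ?_
    rintro rfl
    obtain ⟨y, hy, hay⟩ := Ideal.exists_mul_mem_of_mem_minimalPrimes hq haP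
    exact hy (ha y hay)
  exact (add_le_add_left (Ideal.height_mono hq.1.2) 1).trans
    (Ideal.height_add_one_le_of_lt_of_isPrime hlt)

theorem isSMulRegular_quotient_ofList_iff {R : Type*} [CommRing R] {rs : List R} {z : R} :
    IsSMulRegular (R ⧸ (Ideal.ofList rs • ⊤ : Submodule R R)) z ↔
      ∀ r, z * r ∈ Ideal.ofList rs → r ∈ Ideal.ofList rs := by
  rw [isSMulRegular_iff_right_eq_zero_of_smul, (Submodule.Quotient.mk_surjective _).forall]
  simp only [← Submodule.Quotient.mk_smul, Submodule.Quotient.mk_eq_zero, smul_eq_mul,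
    Ideal.mul_top]

theorem isWeaklyRegular_concat_iff {R : Type*} [CommRing R] {rs : List R} {z : R} :
    IsWeaklyRegular R (rs ++ [z]) ↔ IsWeaklyRegular R rs ∧
      ∀ r, z * r ∈ Ideal.ofList rs → r ∈ Ideal.ofList rs := by
  rw [isWeaklyRegular_append_iff, isWeaklyRegular_singleton_iff,
    isSMulRegular_quotient_ofList_iff]

theorem ofList_le_iff {R : Type*} [CommRing R] {rs : List R} {I : Ideal R} :
    Ideal.ofList rs ≤ I ↔ ∀ r ∈ rs, r ∈ I :=
  Ideal.span_le

theorem isRegular_of_isWeaklyRegular_of_mem {R : Type*} [CommRing R] {I : Ideal R} (hI : I ≠ ⊤)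
    {rs : List R} (hrs : IsWeaklyRegular R rs) (hmem : ∀ r ∈ rs, r ∈ I) : IsRegular R rs := by
  refine ⟨hrs, fun h => hI (top_le_iff.mp ?_)⟩
  rw [smul_eq_mul, Ideal.mul_top] at h
  exact h.trans_le (ofList_le_iff.mpr hmem)

theorem length_le_height_ofList {R : Type*} [CommRing R] {rs : List R}
    (hrs : IsWeaklyRegular R rs) : (rs.length : ℕ∞) ≤ (Ideal.ofList rs).height := by
  induction rs using List.reverseRecOn with
  | nil => simp
  | append_singleton rs z ih =>
    obtain ⟨hrs, hz⟩ := isWeaklyRegular_concat_iff.mp hrs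
    rw [Ideal.height_eq_inf_minimalPrimes]
    refine le_iInf₂ fun P hP => ?_
    have := hP.isPrime
    have hle := ofList_le_iff.mp hP.1.2
    have := height_add_one_le_of_mem (P := P) hz
      (ofList_le_iff.mpr fun r hr => hle r (by simp [hr])) (hle z (by simp))
    refine le_trans ?_ this
    simpa using add_le_add_left (ih hrs) 1

theorem idealGrade_le_height {R : Type*} [CommRing R] (I : Ideal R) :
    idealGrade I ≤ I.height :=
  iSup_le fun rs => (length_le_height_ofList rs.2.2.toIsWeaklyRegular).trans
    (Ideal.height_mono (ofList_le_iff.mpr rs.2.1))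

theorem isAssociatedPrime_quotient_iff {R : Type*} [CommRing R] [IsNoetherianRing R]
    {K P : Ideal R} :
    IsAssociatedPrime P (R ⧸ K) ↔ P.IsPrime ∧ ∃ v, ∀ p, p ∈ P ↔ p * v ∈ K := by
  rw [isAssociatedPrime_iff, (Submodule.Quotient.mk_surjective _).exists]
  simp only [Ideal.ext_iff, Submodule.mem_colon_singleton, ← Submodule.Quotient.mk_smul,
    Submodule.mem_bot, Submodule.Quotient.mk_eq_zero, smul_eq_mul]

/-- The unmixedness property: every associated prime of a weakly regular sequence has height at
most the length of the sequence. -/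
def IsUnmixedRing (R : Type*) [CommRing R] : Prop :=
  ∀ (P : Ideal R) (rs : List R), IsWeaklyRegular R rs →
    IsAssociatedPrime P (R ⧸ Ideal.ofList rs) → P.height ≤ rs.length

theorem isUnmixedRing_of_forall_exists {R : Type*} [CommRing R] [IsNoetherianRing R]
    (h : ∀ (P : Ideal R) [P.IsPrime], ∃ ys : List R, IsWeaklyRegular R ys ∧ (∀ y ∈ ys, y ∈ P) ∧
      P.height ≤ ys.length) : IsUnmixedRing R := by
  intro P rs hrs hP
  obtain ⟨hprime, v, hPv⟩ := isAssociatedPrime_quotient_iff.mp hP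
  obtain ⟨ys, hys, hysP, hle⟩ := h P
  refine hle.trans (Nat.cast_le.mpr ?_)
  refine length_le_length_of_smul_mem hprime.ne_top hrs
    (isRegular_of_isWeaklyRegular_of_mem hprime.ne_top hys hysP) hysP (u := v) (fun hv => ?_)
    fun p hp => (hPv p).mp hp
  exact hprime.ne_top ((Ideal.eq_top_iff_one P).mpr ((hPv 1).mpr (by simpa using hv)))

theorem exists_isRegular_length_eq_idealGrade {R : Type*} [CommRing R] [IsNoetherianRing R]
    {I : Ideal R} (hI : I ≠ ⊤) :
    ∃ ys : List R, IsRegular R ys ∧ (∀ y ∈ ys, y ∈ I) ∧ (ys.length : ℕ∞) = idealGrade I := by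
  have : Nonempty {rs : List R // (∀ r ∈ rs, r ∈ I) ∧ IsRegular R rs} :=
    ⟨⟨[], by simp, isRegular_of_isWeaklyRegular_of_mem hI (.nil R R) (by simp)⟩⟩
  obtain ⟨ys, hys⟩ := ENat.exists_eq_iSup_of_lt_top
    (f := fun rs : {rs : List R // (∀ r ∈ rs, r ∈ I) ∧ IsRegular R rs} => (rs.1.length : ℕ∞))
    ((idealGrade_le_height I).trans_lt (Ideal.height_lt_top hI))
  exact ⟨ys.1, ys.2.2, ys.2.1, hys⟩

namespace IsCohenMacaulayRing

theorem exists_isRegular_length_eq_height {R : Type*} [CommRing R] [IsNoetherianRing R]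
    (h : IsCohenMacaulayRing R) {I : Ideal R} (hI : I ≠ ⊤) :
    ∃ ys : List R, IsRegular R ys ∧ (∀ y ∈ ys, y ∈ I) ∧ (ys.length : ℕ∞) = I.height := by
  rw [← idealHeight_eq_height, ← h I hI]
  exact exists_isRegular_length_eq_idealGrade hI

theorem isUnmixedRing {R : Type*} [CommRing R] [IsNoetherianRing R]
    (h : IsCohenMacaulayRing R) : IsUnmixedRing R :=
  isUnmixedRing_of_forall_exists fun _ hP =>
    let ⟨ys, hys, hmem, hlen⟩ := h.exists_isRegular_length_eq_height hP.ne_top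
    ⟨ys, hys.toIsWeaklyRegular, hmem, hlen.ge⟩

end IsCohenMacaulayRing

theorem exists_le_isAssociatedPrime_of_mul_mem {R : Type*} [CommRing R] [IsNoetherianRing R]
    {K J : Ideal R} {u : R} (hu : u ∉ K) (hJ : ∀ p ∈ J, p * u ∈ K) :
    ∃ P : Ideal R, IsAssociatedPrime P (R ⧸ K) ∧ J ≤ P := by
  have hu' : (Submodule.Quotient.mk u : R ⧸ K) ≠ 0 := by
    rwa [Ne, Submodule.Quotient.mk_eq_zero]
  obtain ⟨P, hP, hle⟩ := exists_le_isAssociatedPrime_of_isNoetherianRing R _ hu'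
  refine ⟨P, hP, fun p hp => hle ?_⟩
  rw [Submodule.mem_colon_singleton, ← Submodule.Quotient.mk_smul, Submodule.mem_bot,
    Submodule.Quotient.mk_eq_zero]
  exact hJ p hp

theorem exists_le_isAssociatedPrime_of_forall_exists_mul_mem {R : Type*} [CommRing R]
    [IsNoetherianRing R] {K J : Ideal R} (h : ∀ z ∈ J, ∃ r, z * r ∈ K ∧ r ∉ K) :
    ∃ P : Ideal R, IsAssociatedPrime P (R ⧸ K) ∧ J ≤ P := by
  refine (Ideal.subset_union_prime_finite (f := id) (associatedPrimes.finite R (R ⧸ K)) ⊥ ⊥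
    (fun P hP _ _ => hP.isPrime)).mp fun z hz => ?_
  obtain ⟨r, hzr, hr⟩ := h z hz
  simp only [id, biUnion_associatedPrimes_eq_zero_divisors R (R ⧸ K)]
  refine ⟨Submodule.Quotient.mk r, ?_, ?_⟩
  · rwa [Ne, Submodule.Quotient.mk_eq_zero]
  · rwa [← Submodule.Quotient.mk_smul, Submodule.Quotient.mk_eq_zero]

theorem IsUnmixedRing.isCohenMacaulayRing {R : Type*} [CommRing R] [IsNoetherianRing R]
    (h : IsUnmixedRing R) : IsCohenMacaulayRing R := by
  intro J hJ
  rw [idealHeight_eq_height]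
  refine le_antisymm (idealGrade_le_height J) ?_
  obtain ⟨ys, hys, hysJ, hlen⟩ := exists_isRegular_length_eq_idealGrade hJ
  have hzero : ∀ z ∈ J, ∃ r, z * r ∈ Ideal.ofList ys ∧ r ∉ Ideal.ofList ys := by
    intro z hz
    by_contra! hz'
    have hmem : ∀ y ∈ ys ++ [z], y ∈ J := by
      simpa [or_imp, forall_and] using ⟨hysJ, hz⟩
    have hreg := isRegular_of_isWeaklyRegular_of_mem hJ
      (isWeaklyRegular_concat_iff.mpr ⟨hys.toIsWeaklyRegular, hz'⟩) hmem
    have hle : ((ys ++ [z]).length : ℕ∞) ≤ idealGrade J :=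
      le_iSup (fun rs : {rs : List R // (∀ r ∈ rs, r ∈ J) ∧ IsRegular R rs} =>
        (rs.1.length : ℕ∞)) ⟨ys ++ [z], hmem, hreg⟩
    rw [← hlen, Nat.cast_le] at hle
    simp at hle
  obtain ⟨P, hP, hJP⟩ := exists_le_isAssociatedPrime_of_forall_exists_mul_mem hzero
  rw [← hlen]
  exact (Ideal.height_mono hJP).trans (h P ys hys.toIsWeaklyRegular hP)

theorem height_add_one_le_height_comap {S T : Type*} [CommRing S] [CommRing T] [IsNoetherianRing T]
    {σ : S →+* T} (hσ : Function.Surjective σ) {f : S} (hf : f ∈ nonZeroDivisors S)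
    (hfσ : σ f = 0) (Q : Ideal T) [Q.IsPrime] : Q.height + 1 ≤ (Q.comap σ).height := by
  obtain ⟨l, hlast, hlen⟩ := Q.exists_ltSeries_length_eq_height
  let l' := l.map (PrimeSpectrum.comap σ) (RingHom.strictMono_comap_of_surjective hσ)
  obtain ⟨q, hq, hql⟩ := Ideal.exists_minimalPrimes_le (J := l'.head.asIdeal) bot_le
  have hlt : (⟨q, hq.isPrime⟩ : PrimeSpectrum S) < l'.head := by
    refine lt_of_le_of_ne hql fun h => ?_
    refine Set.disjoint_left.mp (Ideal.disjoint_nonZeroDivisors_of_mem_minimalPrimes hq)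
      (show f ∈ q from ?_) hf
    have hfl : f ∈ l'.head.asIdeal := by
      simp [l', hfσ]
    rwa [← h] at hfl
  have hle := Order.length_le_height_last (p := l'.cons _ hlt)
  rw [RelSeries.last_cons, LTSeries.last_map, hlast, ← PrimeSpectrum.height_eq_orderHeight] at hle
  rw [← hlen]
  simpa [l'] using hle

open scoped Pointwise in
theorem IsUnmixedRing.of_surjective {S T : Type*} [CommRing S] [CommRing T] [IsNoetherianRing S]
    [IsNoetherianRing T] (h : IsUnmixedRing S) {σ : S →+* T} (hσ : Function.Surjective σ) {f : S}
    (hf : f ∈ nonZeroDivisors S) (hker : RingHom.ker σ = Ideal.span {f}) : IsUnmixedRing T := by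
  intro Q rs hrs hQ
  obtain ⟨hprime, v, hQv⟩ := isAssociatedPrime_quotient_iff.mp hQ
  obtain ⟨rs, rfl⟩ := List.map_surjective_iff.mpr hσ rs
  obtain ⟨v, rfl⟩ := hσ v
  have hfσ : σ f = 0 := by
    rw [← RingHom.mem_ker, hker]
    exact Ideal.mem_span_singleton_self f
  have hcomap : (Ideal.ofList (rs.map σ)).comap σ = Ideal.ofList (f :: rs) := by
    rw [← Ideal.map_ofList, Ideal.comap_map_of_surjective' σ hσ, hker, Ideal.ofList_cons, sup_comm]
  have hreg : IsWeaklyRegular S (f :: rs) := by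
    rw [isWeaklyRegular_cons_iff]
    refine ⟨(isSMulRegular_iff_right_eq_zero_of_smul).mpr fun x hx =>
      (mul_right_mem_nonZeroDivisors_eq_zero_iff hf).mp ((mul_comm x f).trans hx), ?_⟩
    let e : QuotSMulTop f S ≃+ T :=
      (QuotientAddGroup.quotientAddEquivOfEq (by
        ext x
        change x ∈ (f • ⊤ : Submodule S S) ↔ x ∈ RingHom.ker σ
        rw [hker, ← Submodule.ideal_span_singleton_smul, smul_eq_mul, Ideal.mul_top])).trans
      (QuotientAddGroup.quotientKerEquivOfSurjective (σ : S →+ T) hσ)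
    refine (AddEquiv.isWeaklyRegular_congr (e := e) ?_).mpr hrs
    refine List.forall₂_map_right_iff.mpr (List.forall₂_same.mpr fun r _ => ?_)
    refine (Submodule.Quotient.mk_surjective _).forall.mpr fun x => ?_
    exact σ.map_mul r x
  have hle := h (Q.comap σ) (f :: rs) hreg (isAssociatedPrime_quotient_iff.mpr
    ⟨inferInstance, v, fun p => by
      rw [← hcomap, Ideal.mem_comap, Ideal.mem_comap, hQv, map_mul]⟩)
  have := (height_add_one_le_height_comap hσ hf hfσ Q).trans hle
  simpa [ENat.add_le_add_iff_right] using this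

open Polynomial

theorem height_le_one_of_comap_C_eq_bot {D : Type*} [CommRing D] [IsDomain D] {Q : Ideal D[X]}
    [Q.IsPrime] (hQ : Q.comap C = ⊥) : Q.height ≤ 1 := by
  let K := FractionRing D
  let := Polynomial.algebra D K
  have := Polynomial.isLocalization (nonZeroDivisors D) K
  have hdisj : Disjoint (((nonZeroDivisors D).map C : Submonoid D[X]) : Set D[X]) Q := by
    refine Set.disjoint_left.mpr ?_
    rintro _ ⟨d, hd, rfl⟩ hdQ
    have : d ∈ Q.comap C := hdQ
    rw [hQ, Ideal.mem_bot] at this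
    exact nonZeroDivisors.ne_zero hd this
  have hprime := IsLocalization.isPrime_of_isPrime_disjoint _ K[X] Q ‹_› hdisj
  rw [← IsLocalization.height_map_of_disjoint (S := K[X]) _ Q hdisj]
  have := Ideal.height_le_ringKrullDim_of_ne_top hprime.ne_top
  rw [IsPrincipalIdealRing.ringKrullDim_eq_one K[X] (Polynomial.not_isField K)] at this
  exact_mod_cast this

theorem height_le_height_comap_C_add_one {A : Type*} [CommRing A] [IsNoetherianRing A]
    (P : Ideal A[X]) [P.IsPrime] : P.height ≤ (P.comap C).height + 1 := by
  have : P.LiesOver (P.comap C) := ⟨rfl⟩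
  rw [Ideal.height_eq_height_add_of_liesOver_of_hasGoingDown (P.comap C) P]
  gcongr
  have hle : (P.comap C).map C ≤ P := Ideal.map_comap_le
  let e := Ideal.polynomialQuotientEquivQuotientPolynomial (P.comap C)
  have hprime : (P.map (Ideal.Quotient.mk ((P.comap C).map C))).IsPrime :=
    Ideal.map_isPrime_of_surjective Ideal.Quotient.mk_surjective (by rwa [Ideal.mk_ker])
  change (P.map (Ideal.Quotient.mk ((P.comap C).map C))).height ≤ 1
  rw [← RingEquiv.height_comap e]
  refine height_le_one_of_comap_C_eq_bot (eq_bot_iff.mpr ?_)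
  refine Ideal.Quotient.mk_surjective.forall.mpr fun a ha => ?_
  have he : e (C (Ideal.Quotient.mk (P.comap C) a)) = Ideal.Quotient.mk _ (C a) := by
    rw [← Polynomial.map_C]
    exact Ideal.polynomialQuotientEquivQuotientPolynomial_map_mk _ _
  rw [Ideal.mem_comap, Ideal.mem_comap, he,
    Ideal.mem_quotient_iff_mem hle] at ha
  exact Ideal.Quotient.eq_zero_iff_mem.mpr ha

theorem height_map_C_eq_height {A : Type*} [CommRing A] [IsNoetherianRing A]
    (p : Ideal A) [p.IsPrime] : (p.map (C : A →+* A[X])).height = p.height := by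
  have : (p.map (C : A →+* A[X])).LiesOver p := ⟨by
    ext x
    change x ∈ p ↔ C x ∈ p.map (C : A →+* A[X])
    rw [Ideal.mem_map_C_iff]
    refine ⟨fun hx n => ?_, fun h => by simpa using h 0⟩
    rw [coeff_C]
    split_ifs <;> simp [hx]⟩
  have : (p.map (C : A →+* A[X])).IsPrime := Ideal.isPrime_map_C_of_isPrime
  have h := Ideal.height_eq_height_add_of_liesOver_of_hasGoingDown p (p.map (C : A →+* A[X]))
  simpa using h

theorem exists_coeff_mul_mem {A : Type*} [CommRing A] {p K : Ideal A} {f g : A[X]}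
    (hf : f ∉ p.map C) (hg : g ∉ K.map C) (hfg : f * g ∈ K.map C)
    (hpg : ∀ a ∈ p, C a * g ∈ K.map C) :
    ∃ b ∉ p, ∃ u ∉ K, b * u ∈ K ∧ ∀ a ∈ p, a * u ∈ K := by
  have hlead : ∀ {L : Ideal A} {k : A[X]}, k ∉ L.map C →
      ∃ n, k.coeff n ∉ L ∧ ∀ i, n < i → k.coeff i ∈ L := by
    intro L k hk
    have hk' : k.map (Ideal.Quotient.mk L) ≠ 0 := fun h => hk <| Ideal.mem_map_C_iff.mpr fun n => by
      rw [← Ideal.Quotient.eq_zero_iff_mem, ← coeff_map, h, coeff_zero]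
    refine ⟨(k.map (Ideal.Quotient.mk L)).natDegree, fun h => hk' ?_, fun i hi => ?_⟩
    · rwa [← Ideal.Quotient.eq_zero_iff_mem, ← coeff_map, coeff_natDegree,
        leadingCoeff_eq_zero] at h
    · rw [← Ideal.Quotient.eq_zero_iff_mem, ← coeff_map, coeff_eq_zero_of_natDegree_lt hi]
  obtain ⟨m, hm, hm'⟩ := hlead hf
  obtain ⟨n, hn, hn'⟩ := hlead hg
  have hcoeff : ∀ a ∈ p, ∀ j, a * g.coeff j ∈ K := fun a ha j => by
    simpa using Ideal.mem_map_C_iff.mp (hpg a ha) j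
  refine ⟨f.coeff m, hm, g.coeff n, hn, ?_, fun a ha => hcoeff a ha n⟩
  have hsum := Ideal.mem_map_C_iff.mp hfg (m + n)
  rw [coeff_mul, ← Finset.add_sum_erase _ _ (Finset.HasAntidiagonal.mem_antidiagonal.mpr rfl :
    (m, n) ∈ _)] at hsum
  refine (Ideal.add_mem_iff_left _ (Ideal.sum_mem _ fun x hx => ?_)).mp hsum
  rw [Finset.mem_erase, Finset.HasAntidiagonal.mem_antidiagonal, Ne, Prod.ext_iff] at hx
  rcases lt_or_ge m x.1 with h | h
  · exact hcoeff _ (hm' _ h) _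
  · exact Ideal.mul_mem_left _ _ (hn' _ (by grind))

theorem IsCohenMacaulayRing.isUnmixedRing_polynomial {A : Type*} [CommRing A] [IsNoetherianRing A]
    (h : IsCohenMacaulayRing A) : IsUnmixedRing A[X] := by
  refine isUnmixedRing_of_forall_exists fun P hP => ?_
  let p := P.comap C
  have hp : p.IsPrime := inferInstance
  obtain ⟨rs, hrs, hmem, hlen⟩ := h.exists_isRegular_length_eq_height hp.ne_top
  have hrs' : IsWeaklyRegular A[X] (rs.map C) :=
    RingTheory.Sequence.IsWeaklyRegular.of_flat hrs.toIsWeaklyRegular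
  have hmem' : ∀ y ∈ rs.map C, y ∈ P := by
    simpa using show ∀ y ∈ rs, C y ∈ P from hmem
  by_cases hPp : P ≤ p.map C
  · refine ⟨rs.map C, hrs', hmem', ?_⟩
    rw [List.length_map, hlen, ← height_map_C_eq_height p]
    exact Ideal.height_mono hPp
  by_cases hz : ∃ z ∈ P, ∀ r, z * r ∈ Ideal.ofList (rs.map C) → r ∈ Ideal.ofList (rs.map C)
  · obtain ⟨z, hzP, hz⟩ := hz
    refine ⟨rs.map C ++ [z], isWeaklyRegular_concat_iff.mpr ⟨hrs', hz⟩, ?_, ?_⟩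
    · simpa only [List.forall_mem_append, List.forall_mem_singleton] using ⟨hmem', hzP⟩
    · simpa [hlen] using height_le_height_comap_C_add_one P
  · exfalso
    push Not at hz
    obtain ⟨Q, hQ, hPQ⟩ := exists_le_isAssociatedPrime_of_forall_exists_mul_mem hz
    obtain ⟨hQ, g, hg⟩ := isAssociatedPrime_quotient_iff.mp hQ
    rw [← Ideal.map_ofList] at hg
    obtain ⟨f, hfP, hf⟩ := SetLike.not_le_iff_exists.mp hPp
    obtain ⟨b, hb, u, hu, hbu, hpu⟩ := exists_coeff_mul_mem hf
      (fun hgK => hQ.one_notMem ((hg 1).mpr (by rwa [one_mul])))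
      ((hg f).mp (hPQ hfP)) (fun a ha => (hg _).mp (hPQ ha))
    obtain ⟨q, hq, hJq⟩ := exists_le_isAssociatedPrime_of_mul_mem (J := p ⊔ Ideal.span {b}) hu
      (fun x hx => by
        obtain ⟨a, ha, c, hc, rfl⟩ := Submodule.mem_sup.mp hx
        obtain ⟨d, rfl⟩ := Ideal.mem_span_singleton'.mp hc
        rw [add_mul, mul_assoc]
        exact add_mem (hpu a ha) (Ideal.mul_mem_left _ d hbu))
    have hlt : p < q := lt_of_le_of_ne (le_sup_left.trans hJq) fun hpq =>
      hb (hpq ▸ hJq (Ideal.mem_sup_right (Ideal.mem_span_singleton_self b)))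
    have hle := h.isUnmixedRing q rs hrs.toIsWeaklyRegular hq
    rw [hlen] at hle
    have := hq.isPrime
    exact (Ideal.height_strict_mono_of_isPrime_of_isPrime hlt).not_ge hle

theorem isUnmixedRing_quotient_sup_span {R : Type*} [CommRing R] [IsNoetherianRing R] {I : Ideal R}
    (hCM : IsCohenMacaulayRing (R ⧸ I)) {a b : R} (hb : b ∈ I)
    (ha : ∀ r : R, a * r ∈ I → r ∈ I) :
    IsUnmixedRing (R[X] ⧸ (I.map C ⊔ Ideal.span {C a * X + C b})) := by
  let f : (R ⧸ I)[X] := C (Ideal.Quotient.mk I a) * X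
  let π : R[X] →+* (R ⧸ I)[X] := mapRingHom (Ideal.Quotient.mk I)
  have hπ : Function.Surjective π := map_surjective _ Ideal.Quotient.mk_surjective
  have hπker : RingHom.ker π = I.map C := by
    rw [ker_mapRingHom, Ideal.mk_ker]
  have hπf : π (C a * X + C b) = f := by
    simp [π, f, Ideal.Quotient.eq_zero_iff_mem.mpr hb]
  let J := I.map C ⊔ Ideal.span {C a * X + C b}
  have hJ : J = (Ideal.span {f}).comap π := by
    rw [← hπf, ← Set.image_singleton, ← Ideal.map_span, Ideal.comap_map_of_surjective' π hπ, hπker,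
      sup_comm]
  have hτ : RingHom.ker ((Ideal.Quotient.mk (Ideal.span {f})).comp π) = J := by
    rw [← RingHom.comap_ker, Ideal.mk_ker, hJ]
  have hτsurj := (Ideal.Quotient.mk_surjective (I := Ideal.span {f})).comp hπ
  let e : (R[X] ⧸ J) ≃+* (R ⧸ I)[X] ⧸ Ideal.span {f} :=
    (Ideal.quotEquivOfEq hτ.symm).trans (RingHom.quotientKerEquivOfSurjective hτsurj)
  refine hCM.isUnmixedRing_polynomial.of_surjective
    (σ := (e.symm : _ →+* R[X] ⧸ J).comp (Ideal.Quotient.mk (Ideal.span {f})))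
    (f := f) (e.symm.surjective.comp Ideal.Quotient.mk_surjective) ?_ ?_
  · refine mem_nonZeroDivisors_of_leadingCoeff ?_
    rw [leadingCoeff_mul_X, leadingCoeff_C, mem_nonZeroDivisors_iff_right]
    refine Ideal.Quotient.mk_surjective.forall.mpr fun r hr => ?_
    rw [← map_mul, mul_comm, Ideal.Quotient.eq_zero_iff_mem] at hr
    exact Ideal.Quotient.eq_zero_iff_mem.mpr (ha r hr)
  · exact (RingHom.ker_equiv_comp _ e.symm).trans Ideal.mk_ker

theorem height_map_C_sup_span {R : Type*} [CommRing R] [IsNoetherianRing R] {I : Ideal R}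
    {a b : R} (hb : b ∈ I) (ha : ∀ r : R, a * r ∈ I → r ∈ I) :
    (I.map C ⊔ Ideal.span {C a * X + C b}).height = I.height + 1 := by
  refine le_antisymm ?_ ?_
  · rcases eq_or_ne I ⊤ with rfl | hI
    · simp
    obtain ⟨p, hp, hIp, hpI⟩ :=
      Ideal.exists_isPrime_height_eq (ENat.natCast_toNat (Ideal.height_ne_top hI)).symm
    rw [ENat.natCast_toNat (Ideal.height_ne_top hI)] at hpI
    let P := p.comap (evalRingHom (0 : R))
    have hPp : P.comap C = p := by
      ext x
      simp [P]
    refine (Ideal.height_mono (J := P) ?_).trans ?_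
    · refine sup_le (Ideal.map_le_iff_le_comap.mpr (hPp.symm ▸ hIp)) ?_
      rw [Ideal.span_singleton_le_iff_mem]
      simpa [P] using hIp hb
    · rw [← hpI, ← hPp]
      exact height_le_height_comap_C_add_one P
  · rw [Ideal.height_eq_inf_minimalPrimes (I.map C ⊔ _)]
    refine le_iInf₂ fun P hP => ?_
    have := hP.isPrime
    have hIP : I.map C ≤ P := le_sup_left.trans hP.1.2
    have hIp : I ≤ P.comap C := Ideal.map_le_iff_le_comap.mp hIP
    have hle : (P.comap C).map C ≤ P := Ideal.map_comap_le
    have haX : C a * X ∈ P := (Ideal.add_mem_iff_left P (hIp hb)).mp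
      (hP.1.2 (Ideal.mem_sup_right (Ideal.mem_span_singleton_self _)))
    rcases Ideal.IsPrime.mem_or_mem ‹_› haX with haP | hXP
    · refine (height_add_one_le_of_mem ha hIp haP).trans ?_
      rw [← height_map_C_eq_height]
      exact Ideal.height_mono hle
    · refine (add_le_add_left (Ideal.height_mono hIp) 1).trans ?_
      rw [← height_map_C_eq_height]
      have hlt : (P.comap C).map C < P := lt_of_le_of_ne hle fun h => by
        rw [← h, Ideal.mem_map_C_iff] at hXP
        have h1 := hXP 1
        rw [coeff_X_one] at h1
        exact (inferInstance : (P.comap C).IsPrime).one_notMem h1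
      exact Ideal.height_add_one_le_of_lt_of_isPrime hlt

end

/-- if `R/I` is Cohen–Macaulay, `g_d ∈ I`, and `g_{d-1}` is a nonzerodivisor
on `R/I`, then `R[x_n]/(I, g_{d-1}·x_n + g_d)` is Cohen–Macaulay of codimension
`height(I) + 1`. -/
theorem cohenMacaulay_of_monoid_extension
    {R : Type*} [CommRing R] [IsNoetherianRing R] (I : Ideal R)
    (hCM : IsCohenMacaulayRing (R ⧸ I))
    (gd1 gd : R) (hgd : gd ∈ I)
    (hreg : ∀ r : R, gd1 * r ∈ I → r ∈ I) :
    IsCohenMacaulayRing (Polynomial R ⧸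
        (I.map (Polynomial.C : R →+* Polynomial R) ⊔
          Ideal.span {Polynomial.C gd1 * Polynomial.X + Polynomial.C gd})) ∧
      idealHeight (I.map (Polynomial.C : R →+* Polynomial R) ⊔
          Ideal.span {Polynomial.C gd1 * Polynomial.X + Polynomial.C gd}) =
        idealHeight I + 1 := by
  exact ⟨(isUnmixedRing_quotient_sup_span hCM hgd hreg).isCohenMacaulayRing, by
    rw [idealHeight_eq_height, idealHeight_eq_height, height_map_C_sup_span hgd hreg]⟩
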